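/- There exists a constant C_G depending only on the finite group G such that max_{σ ∈ S_non(1/3)} Pr_σ(σ_t ∉ S_non(1/6) for some t ≤ n²) ≤ C_G·n²·e^{−n/10}, where the probability is over the product replacement chain started at σ. -/

import Mathlib

open scoped BigOperators
open Filter

attribute [local instance] Classical.propDecidable

noncomputable section

namespace PR

variable (G : Type) [Group G] [Fintype G]

/-- A configuration: an `n`-tuple of elements of `G`. -/
abbrev Config (n : ℕ) := Fin n → G

/-- The set of generating `n`-tuples. -/
def gens (n : ℕ) : Set (Config G n) :=
  {σ | Subgroup.closure (Set.range σ) = ⊤}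

/-- A move of the product replacement chain: an ordered pair of distinct indices
together with a sign (`true` = multiply, `false` = multiply by inverse). -/
abbrev Move (n : ℕ) := {p : Fin n × Fin n // p.1 ≠ p.2} × Bool

/-- Applying a move: replace `σ i` by `σ i * (σ j)^{±1}`. -/
def applyMove {n : ℕ} (σ : Config G n) (m : Move n) : Config G n :=
  Function.update σ m.1.1.1
    (σ m.1.1.1 * (if m.2 then σ m.1.1.2 else (σ m.1.1.2)⁻¹))

/-- One-step transition probability of the product replacement chain. -/
def step {n : ℕ} (σ σ' : Config G n) : ℝ :=
  ((Finset.univ.filter (fun m : Move n => applyMove G σ m = σ')).card : ℝ) /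
    (Fintype.card (Move n) : ℝ)

/-- The law of `σ_t` for the chain started at `σ₀`. -/
def law {n : ℕ} (σ₀ : Config G n) : ℕ → Config G n → ℝ
  | 0 => fun σ' => if σ' = σ₀ then 1 else 0
  | (t + 1) => fun σ' => ∑ τ : Config G n, law σ₀ t τ * step G τ σ'

/-- Probability that `σ_t ∈ E` for the chain started at `σ₀`. -/
def prob {n : ℕ} (σ₀ : Config G n) (t : ℕ) (E : Set (Config G n)) : ℝ :=
  ∑ τ ∈ Finset.univ.filter (fun τ => τ ∈ E), law G σ₀ t τ

/-- Probability of a trajectory event for the chain started at `σ₀`, over the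
time horizon `{0, 1, …, T}`. -/
def pathProb {n : ℕ} (σ₀ : Config G n) (T : ℕ)
    (E : Set (Fin (T + 1) → Config G n)) : ℝ :=
  ∑ p ∈ Finset.univ.filter
      (fun p : Fin (T + 1) → Config G n => p 0 = σ₀ ∧ p ∈ E),
    ∏ t : Fin T, step G (p t.castSucc) (p t.succ)

/-- `n_a(σ)`: the number of sites holding the group element `a`. -/
def nCount {n : ℕ} (σ : Config G n) (a : G) : ℕ :=
  (Finset.univ.filter (fun i => σ i = a)).card

/-- `n^H_non(σ)`: the number of sites whose element lies outside `H`. -/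
def nNon {n : ℕ} (H : Subgroup G) (σ : Config G n) : ℕ :=
  (Finset.univ.filter (fun i => σ i ∉ H)).card

/-- `n^{id}_non(σ)`: the number of sites not holding the identity. -/
def nNonId {n : ℕ} (σ : Config G n) : ℕ :=
  (Finset.univ.filter (fun i => σ i ≠ 1)).card

/-- `S_non(c)`. -/
def SNon (n : ℕ) (c : ℝ) : Set (Config G n) :=
  {σ | σ ∈ gens G n ∧
    ∀ H : Subgroup G, H ≠ ⊤ → c * n ≤ (nNon G H σ : ℝ)}

/-- The `δ`-typical set `S_*(δ)`. -/
def SAst (n : ℕ) (δ : ℝ) : Set (Config G n) :=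
  {σ | σ ∈ gens G n ∧
    Real.sqrt (∑ a : G, ((nCount G σ a : ℝ) / n - 1 / (Fintype.card G : ℝ)) ^ 2) ≤ δ}

/-- `n^{σ₀}_{a,b}(σ)`. -/
def nab {n : ℕ} (σ₀ σ : Config G n) (a b : G) : ℕ :=
  (Finset.univ.filter (fun i => σ₀ i = a ∧ σ i = b)).card

/-- `S_*(σ₀, r)`. -/
def SAstM {n : ℕ} (σ₀ : Config G n) (r : ℝ) : Set (Config G n) :=
  {σ | σ ∈ gens G n ∧
    ∀ a : G, Real.sqrt (∑ b : G,
      ((nab G σ₀ σ a b : ℝ) / (nCount G σ₀ a : ℝ) - 1 / (Fintype.card G : ℝ)) ^ 2) ≤ r}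

/-- The uniform stationary distribution `π` on the set of generating tuples. -/
def statDist (n : ℕ) : Config G n → ℝ := fun σ =>
  if σ ∈ gens G n then
    1 / ((Finset.univ.filter (fun τ : Config G n => τ ∈ gens G n)).card : ℝ)
  else 0

/-- Total-variation distance between two (finitely supported) signed weights,
as the supremum over finite sets `A` of `|p(A) - q(A)|`. -/
def tvDist {α : Type*} (p q : α → ℝ) : ℝ :=
  sSup {x : ℝ | ∃ A : Finset α, x = |∑ a ∈ A, p a - ∑ a ∈ A, q a|}

/-- `d_σ(t) = max_{A ⊆ S} |P_σ(σ_t ∈ A) - π(A)|`. -/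
def dTV {n : ℕ} (σ : Config G n) (t : ℕ) : ℝ :=
  sSup {x : ℝ | ∃ A : Finset (Config G n), ↑A ⊆ gens G n ∧
    x = |∑ τ ∈ A, law G σ t τ - ∑ τ ∈ A, statDist G n τ|}

/-- `max_{σ ∈ S} d_σ(t)`. -/
def dMax (n : ℕ) (t : ℕ) : ℝ :=
  sSup {x : ℝ | ∃ σ ∈ gens G n, x = dTV G σ t}

end PR

namespace PR

section PathProb

variable {G : Type} [Group G] {n : ℕ}

theorem step_nonneg (σ τ : Config G n) : 0 ≤ step G σ τ := by
  unfold step; positivity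

variable [Fintype G]

/-- Averaging a function against one step of the chain is averaging over the moves. -/
theorem sum_step_mul (σ : Config G n) (f : Config G n → ℝ) :
    ∑ τ, step G σ τ * f τ
      = (∑ m : Move n, f (applyMove G σ m)) / (Fintype.card (Move n) : ℝ) := by
  have key : ∑ m : Move n, f (applyMove G σ m) = ∑ τ : Config G n,
      ((Finset.univ.filter (fun m : Move n => applyMove G σ m = τ)).card : ℝ) * f τ := by
    rw [← Finset.sum_fiberwise Finset.univ (applyMove G σ)]
    refine Finset.sum_congr rfl fun τ _ => ?_
    rw [← nsmul_eq_mul, ← Finset.sum_const]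
    refine Finset.sum_congr (by congr) fun m hm => ?_
    rw [(Finset.mem_filter.1 hm).2]
  rw [key, Finset.sum_div]
  refine Finset.sum_congr rfl fun τ _ => ?_
  rw [step]
  ring

theorem sum_step_le_of_sum_moves_le (σ : Config G n) (f : Config G n → ℝ) {c : ℝ} (hc : 0 ≤ c)
    (h : ∑ m : Move n, f (applyMove G σ m) ≤ Fintype.card (Move n) * c) :
    ∑ τ, step G σ τ * f τ ≤ c := by
  rw [sum_step_mul]
  exact div_le_of_le_mul₀ (by positivity) hc (by linarith)

/-- First-step decomposition of trajectory probabilities. -/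
theorem pathProb_succ (σ : Config G n) (T : ℕ) (E : Set (Fin (T + 1 + 1) → Config G n)) :
    pathProb G σ (T + 1) E
      = ∑ τ, step G σ τ * pathProb G τ T {q | (Fin.cons σ q : Fin (T + 1 + 1) → Config G n) ∈ E} := by
  simp only [pathProb, Finset.sum_filter, Finset.mul_sum]
  rw [Finset.sum_comm, ← (Fin.consEquiv (fun _ : Fin (T + 1 + 1) => Config G n)).sum_comp,
    Fintype.sum_prod_type_right]
  refine Finset.sum_congr rfl fun q _ => ?_
  rw [Finset.sum_eq_single σ, Finset.sum_eq_single (q 0)]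
  · simp [Fin.prod_univ_succ, Fin.consEquiv]
  · intro τ _ hτ
    simp [hτ.symm]
  · simp
  · intro τ _ hτ
    simp [Fin.consEquiv, hτ]
  · simp

theorem pathProb_le_one (T : ℕ) (σ : Config G n) (E : Set (Fin (T + 1) → Config G n)) :
    pathProb G σ T E ≤ 1 := by
  induction T generalizing σ with
  | zero =>
    have : (Finset.univ.filter
        (fun p : Fin (0 + 1) → Config G n => p 0 = σ ∧ p ∈ E)).card ≤ 1 := by
      rw [Finset.card_le_one]
      intro p hp q hq
      funext t
      rw [Fin.fin_one_eq_zero t, (Finset.mem_filter.1 hp).2.1, (Finset.mem_filter.1 hq).2.1]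
    simpa [pathProb] using this
  | succ T ih =>
    rw [pathProb_succ]
    refine (Finset.sum_le_sum fun τ _ =>
      mul_le_mul_of_nonneg_left (ih τ _) (step_nonneg σ τ)).trans ?_
    exact sum_step_le_of_sum_moves_le σ (fun _ => 1) zero_le_one (by simp)

theorem pathProb_zero_eq_zero {σ : Config G n} {E : Set (Fin (0 + 1) → Config G n)}
    (hE : ∀ p ∈ E, p 0 ≠ σ) : pathProb G σ 0 E = 0 :=
  Finset.sum_eq_zero fun p hp =>
    absurd (Finset.mem_filter.1 hp).2.1 (hE p (Finset.mem_filter.1 hp).2.2)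

theorem pathProb_zero_exit {S : Set (Config G n)} {σ : Config G n} (hσ : σ ∈ S) :
    pathProb G σ 0 {p | ∃ t, p t ∉ S} = 0 := by
  refine pathProb_zero_eq_zero ?_
  rintro p ⟨t, ht⟩ rfl
  exact ht (Fin.fin_one_eq_zero t ▸ hσ)

/-- A time-dependent superharmonic function that is at least `1` off `S` bounds the
probability of leaving `S`. -/
theorem pathProb_exit_le {S : Set (Config G n)} (Φ : ℕ → Config G n → ℝ)
    (h_nonneg : ∀ T σ, 0 ≤ Φ T σ) (h_exit : ∀ T, ∀ σ ∉ S, 1 ≤ Φ T σ)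
    (h_step : ∀ T σ, ∑ τ, step G σ τ * Φ T τ ≤ Φ (T + 1) σ) (T : ℕ) (σ : Config G n) :
    pathProb G σ T {p | ∃ t, p t ∉ S} ≤ Φ T σ := by
  induction T generalizing σ with
  | zero =>
    by_cases hσ : σ ∈ S
    · exact (pathProb_zero_exit hσ).trans_le (h_nonneg 0 σ)
    · exact (pathProb_le_one _ _ _).trans (h_exit 0 σ hσ)
  | succ T ih =>
    by_cases hσ : σ ∈ S
    · rw [pathProb_succ]
      refine (Finset.sum_le_sum fun τ _ =>
        mul_le_mul_of_nonneg_left (?_ : _ ≤ Φ T τ) (step_nonneg σ τ)).trans (h_step T σ)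
      convert ih τ using 2
      ext q
      simp [Fin.exists_fin_succ, hσ]
    · exact (pathProb_le_one _ _ _).trans (h_exit _ σ hσ)

end PathProb

section Drift

variable {G : Type} [Group G] {n : ℕ}

theorem nNon_eq_sum (H : Subgroup G) (σ : Config G n) :
    (nNon G H σ : ℝ) = ∑ i, if σ i ∈ H then (0 : ℝ) else 1 := by
  simp [nNon, Finset.sum_ite]

theorem nNon_applyMove_add (H : Subgroup G) (σ : Config G n) (m : Move n) :
    (nNon G H (applyMove G σ m) : ℝ) + (if σ m.1.1.1 ∈ H then 0 else 1)
      = nNon G H σ + (if applyMove G σ m m.1.1.1 ∈ H then 0 else 1) := by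
  rw [nNon_eq_sum, nNon_eq_sum, ← Finset.add_sum_erase _ _ (Finset.mem_univ m.1.1.1),
    ← Finset.add_sum_erase (a := m.1.1.1) _ (fun i => if σ i ∈ H then (0 : ℝ) else 1)
      (Finset.mem_univ m.1.1.1)]
  have : ∀ i ∈ Finset.univ.erase m.1.1.1,
      (if applyMove G σ m i ∈ H then (0 : ℝ) else 1) = if σ i ∈ H then 0 else 1 := by
    intro i hi
    rw [applyMove, Function.update_of_ne (Finset.ne_of_mem_erase hi)]
  rw [Finset.sum_congr rfl this]
  ring

/-- Bound on the relative change of `2 ^ (-n^H_non)` under a move of the ordered pair `(i, j)`. -/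
def driftBound (H : Subgroup G) (σ : Config G n) (p : Fin n × Fin n) : ℝ :=
  (if σ p.2 ∈ H then 0 else 1) * (if σ p.1 ∈ H then -(1 / 2) else 1)

theorem two_rpow_nNon_applyMove_le (H : Subgroup G) (σ : Config G n) (m : Move n) :
    (2 : ℝ) ^ (-(nNon G H (applyMove G σ m) : ℝ))
      ≤ (2 : ℝ) ^ (-(nNon G H σ : ℝ)) * (1 + driftBound H σ m.1.1) := by
  have h := nNon_applyMove_add H σ m
  have hpos : (0 : ℝ) < (2 : ℝ) ^ (-(nNon G H σ : ℝ)) := by positivity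
  obtain ⟨⟨⟨i, j⟩, hij⟩, b⟩ := m
  have hval : applyMove G σ ⟨⟨(i, j), hij⟩, b⟩ i = σ i * (if b then σ j else (σ j)⁻¹) := by
    simp [applyMove]
  have hj : (if b then σ j else (σ j)⁻¹) ∈ H ↔ σ j ∈ H := by
    cases b <;> simp
  simp only [driftBound] at h ⊢
  rw [hval] at h
  have main : ∀ d c : ℝ, (nNon G H (applyMove G σ ⟨⟨(i, j), hij⟩, b⟩) : ℝ) = nNon G H σ + d →
      (2 : ℝ) ^ (-d) ≤ c → (2 : ℝ) ^ (-(nNon G H (applyMove G σ ⟨⟨(i, j), hij⟩, b⟩) : ℝ))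
        ≤ (2 : ℝ) ^ (-(nNon G H σ : ℝ)) * c := by
    intro d c hd hc
    rw [hd, neg_add, Real.rpow_add two_pos]
    exact mul_le_mul_of_nonneg_left hc hpos.le
  by_cases h2 : σ j ∈ H
  · refine main 0 _ ?_ (by simp [h2])
    rw [H.mul_mem_cancel_right (hj.2 h2)] at h
    linarith
  · by_cases h1 : σ i ∈ H
    · rw [H.mul_mem_cancel_left h1, hj] at h
      refine main 1 _ ?_ (by simp [h1, h2, Real.rpow_neg_one]; norm_num)
      simpa [h1, h2] using h
    · by_cases h3 : σ i * (if b then σ j else (σ j)⁻¹) ∈ H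
      · refine main (-1) _ ?_ (by simp [h1, h2]; norm_num)
        simp only [h1, h3, if_true, if_false] at h
        linarith
      · refine main 0 _ ?_ (by simp [h1, h2])
        simp only [h1, h3, if_false] at h
        linarith

theorem sum_driftBound_nonpos (H : Subgroup G) (σ : Config G n) (h : 3 * nNon G H σ ≤ n) :
    ∑ m : Move n, driftBound H σ m.1.1 ≤ 0 := by
  have hall : ∑ p : Fin n × Fin n, driftBound H σ p ≤ 0 := by
    have h1 : ∑ i, (if σ i ∈ H then -(1 / 2 : ℝ) else 1)
        = 3 / 2 * (nNon G H σ : ℝ) - n / 2 := by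
      have : ∀ i, (if σ i ∈ H then -(1 / 2 : ℝ) else 1)
          = 3 / 2 * (if σ i ∈ H then 0 else 1) - 1 / 2 := by
        intro i; split_ifs <;> norm_num
      rw [Finset.sum_congr rfl fun i _ => this i, Finset.sum_sub_distrib, ← Finset.mul_sum,
        ← nNon_eq_sum]
      simp
      ring
    have hprod : ∑ p : Fin n × Fin n, driftBound H σ p
        = (∑ j, if σ j ∈ H then (0 : ℝ) else 1) * ∑ i, if σ i ∈ H then -(1 / 2 : ℝ) else 1 := by
      rw [Fintype.sum_prod_type_right, Finset.sum_mul_sum]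
      rfl
    rw [hprod, h1, ← nNon_eq_sum]
    have : (3 * nNon G H σ : ℝ) ≤ n := by exact_mod_cast h
    exact mul_nonpos_of_nonneg_of_nonpos (by positivity) (by linarith)
  have hsub : ∑ p : {p : Fin n × Fin n // p.1 ≠ p.2}, driftBound H σ p
      ≤ ∑ p : Fin n × Fin n, driftBound H σ p := by
    rw [← Finset.sum_subtype (Finset.univ.filter fun p : Fin n × Fin n => p.1 ≠ p.2)
      (by simp) (driftBound H σ)]
    refine Finset.sum_le_sum_of_subset_of_nonneg (Finset.filter_subset _ _) ?_
    rintro ⟨i, j⟩ - hp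
    obtain rfl : i = j := by simpa using hp
    by_cases hi : σ i ∈ H <;> simp [driftBound, hi]
  rw [Fintype.sum_prod_type]
  simp only [Finset.sum_const, ← Finset.smul_sum]
  exact nsmul_nonpos (hsub.trans hall) _

variable [Fintype G]

theorem sum_step_two_rpow_nNon_le (H : Subgroup G) (σ : Config G n) :
    ∑ τ, step G σ τ * (2 : ℝ) ^ (-(nNon G H τ : ℝ))
      ≤ (2 : ℝ) ^ (-(nNon G H σ : ℝ)) + (2 : ℝ) ^ (-(n : ℝ) / 3) := by
  refine sum_step_le_of_sum_moves_le σ _ (by positivity) ?_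
  have hpos : (0 : ℝ) < (2 : ℝ) ^ (-(nNon G H σ : ℝ)) := by positivity
  have hpos' : (0 : ℝ) < (2 : ℝ) ^ (-(n : ℝ) / 3) := by positivity
  refine (Finset.sum_le_sum fun m _ => two_rpow_nNon_applyMove_le H σ m).trans ?_
  rcases le_or_gt (3 * nNon G H σ) n with h | h
  · rw [← Finset.mul_sum, Finset.sum_add_distrib]
    have h0 := sum_driftBound_nonpos H σ h
    simp only [Finset.sum_const, Finset.card_univ, nsmul_eq_mul, mul_one]
    have hc : (0 : ℝ) ≤ Fintype.card (Move n) := by positivity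
    nlinarith [mul_nonneg hpos.le (neg_nonneg.2 h0), mul_nonneg hc hpos'.le]
  · have hle : (2 : ℝ) ^ (-(nNon G H σ : ℝ)) ≤ (2 : ℝ) ^ (-(n : ℝ) / 3) := by
      refine Real.rpow_le_rpow_of_exponent_le one_le_two ?_
      have : (n : ℝ) < 3 * nNon G H σ := by exact_mod_cast h
      linarith
    rw [← nsmul_eq_mul, ← Finset.card_univ]
    refine Finset.sum_le_card_nsmul _ _ _ fun m _ => ?_
    have : driftBound H σ m.1.1 ≤ 1 := by
      unfold driftBound; split_ifs <;> norm_num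
    nlinarith

/-- The potential bounding the probability of leaving `S_non(1/6)` within `T` steps. -/
def exitPotential (T : ℕ) (σ : Config G n) : ℝ :=
  ∑ H ∈ Finset.univ.filter (fun H : Subgroup G => H ≠ ⊤),
    (2 : ℝ) ^ ((n : ℝ) / 6) * ((2 : ℝ) ^ (-(nNon G H σ : ℝ)) + T * (2 : ℝ) ^ (-(n : ℝ) / 3))

theorem one_le_exitPotential (T : ℕ) {σ : Config G n} (hσ : σ ∉ SNon G n (1 / 6)) :
    1 ≤ exitPotential T σ := by
  obtain ⟨H, hH, hlt⟩ : ∃ H : Subgroup G, H ≠ ⊤ ∧ (nNon G H σ : ℝ) ≤ n / 6 := by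
    by_contra! hcon
    refine hσ ⟨?_, fun H hH => ?_⟩
    · by_contra hgen
      have := hcon (Subgroup.closure (Set.range σ)) hgen
      have h0 : nNon G (Subgroup.closure (Set.range σ)) σ = 0 := by
        rw [nNon, Finset.card_eq_zero, Finset.filter_eq_empty_iff]
        exact fun i _ hi => hi (Subgroup.subset_closure ⟨i, rfl⟩)
      rw [h0] at this
      have : (0 : ℝ) ≤ n := by positivity
      push_cast at *
      linarith
    · linarith [hcon H hH]
  have hterm : (1 : ℝ) ≤ (2 : ℝ) ^ ((n : ℝ) / 6) *
      ((2 : ℝ) ^ (-(nNon G H σ : ℝ)) + T * (2 : ℝ) ^ (-(n : ℝ) / 3)) := by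
    rw [mul_add, ← Real.rpow_add two_pos]
    have : (1 : ℝ) ≤ (2 : ℝ) ^ ((n : ℝ) / 6 + -(nNon G H σ : ℝ)) :=
      Real.one_le_rpow one_le_two (by linarith)
    have : (0 : ℝ) ≤ (2 : ℝ) ^ ((n : ℝ) / 6) * (T * (2 : ℝ) ^ (-(n : ℝ) / 3)) := by positivity
    linarith
  refine hterm.trans (Finset.single_le_sum (f := fun H : Subgroup G => (2 : ℝ) ^ ((n : ℝ) / 6) *
    ((2 : ℝ) ^ (-(nNon G H σ : ℝ)) + T * (2 : ℝ) ^ (-(n : ℝ) / 3)))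
    (fun _ _ => by positivity) ?_)
  simpa using hH

theorem sum_step_exitPotential_le (T : ℕ) (σ : Config G n) :
    ∑ τ, step G σ τ * exitPotential T τ ≤ exitPotential (T + 1) σ := by
  simp only [exitPotential, Finset.mul_sum]
  rw [Finset.sum_comm]
  refine Finset.sum_le_sum fun H _ => ?_
  have h1 := sum_step_two_rpow_nNon_le H σ
  have h2 : ∑ τ, step G σ τ * ((T : ℝ) * (2 : ℝ) ^ (-(n : ℝ) / 3))
      ≤ (T : ℝ) * (2 : ℝ) ^ (-(n : ℝ) / 3) :=
    sum_step_le_of_sum_moves_le σ _ (by positivity) (by simp)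
  simp only [mul_left_comm (step G σ _) ((2 : ℝ) ^ ((n : ℝ) / 6)), ← Finset.mul_sum]
  refine mul_le_mul_of_nonneg_left ?_ (by positivity)
  simp only [mul_add, Finset.sum_add_distrib]
  push_cast
  linarith

theorem exitPotential_le {T : ℕ} {σ : Config G n} (hσ : σ ∈ SNon G n (1 / 3)) :
    exitPotential T σ
      ≤ Fintype.card (Subgroup G) * ((1 + T) * Real.exp (-(n : ℝ) / 10)) := by
  have hexp : (2 : ℝ) ^ ((n : ℝ) / 6) * (2 : ℝ) ^ (-(n : ℝ) / 3) ≤ Real.exp (-(n : ℝ) / 10) := by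
    rw [← Real.rpow_add two_pos, Real.rpow_def_of_pos two_pos]
    refine Real.exp_le_exp.2 ?_
    have := Real.log_two_gt_d9
    have hn : (0 : ℝ) ≤ n := by positivity
    nlinarith
  rw [← nsmul_eq_mul]
  refine (Finset.sum_le_card_nsmul _ _ ((1 + T) * Real.exp (-(n : ℝ) / 10))
    fun H hH => ?_).trans (nsmul_le_nsmul_left (by positivity) (Finset.card_le_univ _))
  have hN : (2 : ℝ) ^ (-(nNon G H σ : ℝ)) ≤ (2 : ℝ) ^ (-(n : ℝ) / 3) := by
    refine Real.rpow_le_rpow_of_exponent_le one_le_two ?_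
    linarith [hσ.2 H (Finset.mem_filter.1 hH).2]
  calc (2 : ℝ) ^ ((n : ℝ) / 6) * ((2 : ℝ) ^ (-(nNon G H σ : ℝ)) + T * (2 : ℝ) ^ (-(n : ℝ) / 3))
      ≤ (2 : ℝ) ^ ((n : ℝ) / 6) * ((2 : ℝ) ^ (-(n : ℝ) / 3) + T * (2 : ℝ) ^ (-(n : ℝ) / 3)) := by
        gcongr
    _ = (1 + T) * ((2 : ℝ) ^ ((n : ℝ) / 6) * (2 : ℝ) ^ (-(n : ℝ) / 3)) := by ring
    _ ≤ (1 + T) * Real.exp (-(n : ℝ) / 10) := by gcongr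

end Drift

end PR

/-- Lemma 2.1, second part: there is a constant `C_G` depending only on `G`
such that `max_{σ ∈ S_non(1/3)} Pr_σ(σ_t ∉ S_non(1/6) for some t ≤ n²) ≤ C_G n² e^{−n/10}`. -/
theorem stay_in_SNon_onesixth
    (G : Type) [Group G] [Fintype G] :
    ∃ C : ℝ, ∀ n : ℕ, ∀ σ ∈ PR.SNon G n (1 / 3),
      PR.pathProb G σ (n ^ 2)
        {p | ∃ t, p t ∉ PR.SNon G n (1 / 6)}
      ≤ C * (n : ℝ) ^ 2 * Real.exp (-(n : ℝ) / 10) := by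
  refine ⟨2 * Fintype.card (Subgroup G), fun n σ hσ => ?_⟩
  rcases Nat.eq_zero_or_pos n with rfl | hn
  · have hσ' : σ ∈ PR.SNon G 0 (1 / 6) := ⟨hσ.1, fun H _ => by simp⟩
    have := PR.pathProb_zero_exit hσ'
    simpa using this.le
  · refine (PR.pathProb_exit_le PR.exitPotential
      (fun T τ => Finset.sum_nonneg fun _ _ => by positivity)
      (fun T _ => PR.one_le_exitPotential T) PR.sum_step_exitPotential_le _ σ).trans
      ((PR.exitPotential_le hσ).trans ?_)
    have h1 : (1 : ℝ) ≤ (n : ℝ) ^ 2 := one_le_pow₀ (by exact_mod_cast hn)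
    calc (Fintype.card (Subgroup G) : ℝ) * ((1 + (n ^ 2 : ℕ)) * Real.exp (-(n : ℝ) / 10))
        ≤ Fintype.card (Subgroup G) * ((2 * (n : ℝ) ^ 2) * Real.exp (-(n : ℝ) / 10)) := by
          gcongr
          push_cast
          linarith
      _ = 2 * Fintype.card (Subgroup G) * (n : ℝ) ^ 2 * Real.exp (-(n : ℝ) / 10) := by ring
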